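/- arXiv:2605.00298 — 4 statements merged into one kernel-verified Lean document; each statement's English description precedes it below -/
import Mathlib

section
/- Fix i ∈ {1,…,N} and suppose w_i : [0,1] → ℝ^d is differentiable and satisfies the first-order optimality condition ∇F_{S,t,i}(w_i(t)) = 0 for every t ∈ [0,1] (in particular this holds when w_i(t) is the global minimizer of the α-strongly convex function F_{S,t,i}). Then for every t ∈ [0,1] the Hessian H_{i,t} := ∇²F_{S,t,i}(w_i(t)) is invertible and w_i'(t) = H_{i,t}⁻¹ ∇ℓ_i(w_i(t)). In particular, at t = 0, w_i'(0) = H₀⁻¹ g_i where H₀ := ∇²F_S(ŵ), ŵ := w_i(0) and g_i := ∇ℓ_i(ŵ). -/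
open scoped RealInnerProductSpace BigOperators

/-- The Hessian of `f : ℝ^d → ℝ` at `w`, viewed as a continuous linear map on `ℝ^d`,
obtained as the Fréchet derivative of the gradient map. -/
noncomputable def hessian {d : ℕ} (f : EuclideanSpace ℝ (Fin d) → ℝ)
    (w : EuclideanSpace ℝ (Fin d)) :
    EuclideanSpace ℝ (Fin d) →L[ℝ] EuclideanSpace ℝ (Fin d) :=
  fderiv ℝ (gradient f) w

/-- The regularized empirical risk `F_S(w) = ∑ i, ℓ_i(w) + λ · Reg(w)`. -/
noncomputable def FS {d N : ℕ} (l : Fin N → EuclideanSpace ℝ (Fin d) → ℝ)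
    (Reg : EuclideanSpace ℝ (Fin d) → ℝ) (lam : ℝ)
    (w : EuclideanSpace ℝ (Fin d)) : ℝ :=
  (∑ i, l i w) + lam * Reg w

/-- The deletion-path objective `F_{S,t,i}(w) = F_S(w) − t · ℓ_i(w)`. -/
noncomputable def FSt {d N : ℕ} (l : Fin N → EuclideanSpace ℝ (Fin d) → ℝ)
    (Reg : EuclideanSpace ℝ (Fin d) → ℝ) (lam : ℝ) (i : Fin N) (t : ℝ)
    (w : EuclideanSpace ℝ (Fin d)) : ℝ :=
  FS l Reg lam w - t * l i w

theorem differentiable_gradient_aux {d : ℕ} {f : EuclideanSpace ℝ (Fin d) → ℝ}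
    (hf : ContDiff ℝ 2 f) : Differentiable ℝ (gradient f) := by
  have h1 : Differentiable ℝ (fderiv ℝ f) :=
    (hf.fderiv_right (m := 1) (by norm_num)).differentiable (by norm_num)
  intro x
  exact ((InnerProductSpace.toDual ℝ (EuclideanSpace ℝ (Fin d))).symm.toContinuousLinearEquiv.differentiable
    _).comp x (h1 x)

theorem gradient_FSt_aux {d N : ℕ} (l : Fin N → EuclideanSpace ℝ (Fin d) → ℝ)
    (Reg : EuclideanSpace ℝ (Fin d) → ℝ) (lam : ℝ) (i : Fin N) (t : ℝ)
    (hF : Differentiable ℝ (FS l Reg lam)) (hl : Differentiable ℝ (l i)) :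
    gradient (FSt l Reg lam i t) =
      fun w => gradient (FS l Reg lam) w - t • gradient (l i) w := by
  funext w
  have h := (hF w).hasFDerivAt.sub ((hl w).hasFDerivAt.const_mul t)
  have h2 : fderiv ℝ (FSt l Reg lam i t) w =
    fderiv ℝ (FS l Reg lam) w - t • fderiv ℝ (l i) w := h.fderiv
  simp only [gradient, h2, map_sub, map_smul]

theorem isUnit_aux {d : ℕ} (A : EuclideanSpace ℝ (Fin d) →L[ℝ] EuclideanSpace ℝ (Fin d))
    {α : ℝ} (hα : 0 < α) (h : ∀ v, α * ‖v‖ ^ 2 ≤ ⟪A v, v⟫) : IsUnit A := by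
  have hinj : Function.Injective A := by
    rw [injective_iff_map_eq_zero]
    intro v hv
    have := h v
    rw [hv, inner_zero_left] at this
    by_contra hne
    have : 0 < ‖v‖ := norm_pos_iff.mpr hne
    have : 0 < α * ‖v‖ ^ 2 := by positivity
    linarith
  have hsurj : Function.Surjective A :=
    LinearMap.injective_iff_surjective (f := (A : EuclideanSpace ℝ (Fin d) →ₗ[ℝ] _)).mp hinj
  exact ContinuousLinearMap.isUnit_iff_bijective.mpr ⟨hinj, hsurj⟩

/-- along the deletion path, the Hessian `H_{i,t} = ∇²F_{S,t,i}(w_i(t))` is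
invertible and `w_i'(t) = H_{i,t}⁻¹ ∇ℓ_i(w_i(t))`; in particular at `t = 0`,
`w_i'(0) = H₀⁻¹ g_i` with `H₀ = ∇²F_S(ŵ)`, `ŵ = w_i(0)`, `g_i = ∇ℓ_i(ŵ)`. -/
theorem stmt0 {d N : ℕ} (hd : 1 ≤ d) (hN : 1 ≤ N)
    (l : Fin N → EuclideanSpace ℝ (Fin d) → ℝ)
    (Reg : EuclideanSpace ℝ (Fin d) → ℝ)
    (lam G H β βR α : ℝ) (hlam : 0 < lam) (hα : 0 < α)
    -- (A1) smooth losses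
    (hl : ∀ i, ContDiff ℝ 2 (l i))
    (hlG : ∀ i w, ‖gradient (l i) w‖ ≤ G)
    (hlH : ∀ i w, ‖hessian (l i) w‖ ≤ H)
    (hlLip : ∀ i w v, ‖hessian (l i) w - hessian (l i) v‖ ≤ β * ‖w - v‖)
    -- (A2) smooth regularizer
    (hReg : ContDiff ℝ 2 Reg)
    (hRegLip : ∀ w v, ‖hessian Reg w - hessian Reg v‖ ≤ βR * ‖w - v‖)
    -- (A3) strong convexity of every F_{S,t,i}
    (hSC : ∀ (i : Fin N) (t : ℝ), t ∈ Set.Icc (0 : ℝ) 1 →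
      ∀ w v : EuclideanSpace ℝ (Fin d),
        α * ‖v‖ ^ 2 ≤ ⟪hessian (FSt l Reg lam i t) w v, v⟫)
    -- the curve and its derivative, with first-order optimality along the path
    (i : Fin N) (w w' : ℝ → EuclideanSpace ℝ (Fin d))
    (hw : ∀ t ∈ Set.Icc (0 : ℝ) 1, HasDerivWithinAt w (w' t) (Set.Icc (0 : ℝ) 1) t)
    (hopt : ∀ t ∈ Set.Icc (0 : ℝ) 1, gradient (FSt l Reg lam i t) (w t) = 0) :
    (∀ t ∈ Set.Icc (0 : ℝ) 1,
      IsUnit (hessian (FSt l Reg lam i t) (w t)) ∧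
      w' t = Ring.inverse (hessian (FSt l Reg lam i t) (w t)) (gradient (l i) (w t))) ∧
    w' 0 = Ring.inverse (hessian (FS l Reg lam) (w 0)) (gradient (l i) (w 0)) := by
  have hFc : ContDiff ℝ 2 (FS l Reg lam) := by
    unfold FS
    exact (ContDiff.sum fun i _ => hl i).add (contDiff_const.mul hReg)
  have hFd := hFc.differentiable (by norm_num)
  have hld := (hl i).differentiable (by norm_num)
  have hgF := differentiable_gradient_aux hFc
  have hgl := differentiable_gradient_aux (hl i)
  have hgrad := fun t => gradient_FSt_aux l Reg lam i t hFd hld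
  have main : ∀ t ∈ Set.Icc (0 : ℝ) 1,
      IsUnit (hessian (FSt l Reg lam i t) (w t)) ∧
      w' t = Ring.inverse (hessian (FSt l Reg lam i t) (w t)) (gradient (l i) (w t)) := by
    intro t ht
    have hu := isUnit_aux _ hα (hSC i t ht (w t))
    refine ⟨hu, ?_⟩
    have hH : hessian (FSt l Reg lam i t) (w t) =
        fderiv ℝ (gradient (FS l Reg lam)) (w t) - t • fderiv ℝ (gradient (l i)) (w t) := by
      unfold hessian
      rw [hgrad t]
      exact ((hgF (w t)).hasFDerivAt.sub ((hgl (w t)).hasFDerivAt.const_smul t)).fderiv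
    have h1 := (hgF (w t)).hasFDerivAt.comp_hasDerivWithinAt t (hw t ht)
    have h2 := (hgl (w t)).hasFDerivAt.comp_hasDerivWithinAt t (hw t ht)
    have h3 := h1.sub ((hasDerivWithinAt_id t (Set.Icc (0 : ℝ) 1)).smul h2)
    have h0 : HasDerivWithinAt (fun _ : ℝ => (0 : EuclideanSpace ℝ (Fin d))) 0
        (Set.Icc (0 : ℝ) 1) t := hasDerivWithinAt_const _ _ _
    have h4 : HasDerivWithinAt (fun s : ℝ => gradient (FS l Reg lam) (w s) - s • gradient (l i) (w s)) 0
        (Set.Icc (0 : ℝ) 1) t := h0.congr_of_mem (fun s hs => by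
      have := hopt s hs
      rw [hgrad s] at this
      exact this) ht
    have h5 := (uniqueDiffOn_Icc (zero_lt_one' ℝ) t ht).eq_deriv _ h3 h4
    have h6 : hessian (FSt l Reg lam i t) (w t) (w' t) = gradient (l i) (w t) := by
      rw [hH]
      simp only [id, one_smul, Function.comp] at h5
      simp only [ContinuousLinearMap.sub_apply, ContinuousLinearMap.smul_apply]
      rw [← sub_eq_zero, ← h5]
      abel
    rw [← h6, ← ContinuousLinearMap.mul_apply, Ring.inverse_mul_cancel _ hu]
    rfl
  refine ⟨main, ?_⟩
  have h := (main 0 (by simp)).2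
  have e : FSt l Reg lam i 0 = FS l Reg lam := by
    funext x; simp [FSt]
  rwa [e] at h
end

section
/- Fix i ∈ {1,…,N} and suppose w_i : [0,1] → ℝ^d is continuously differentiable with ∇F_{S,t,i}(w_i(t)) = 0 for every t ∈ [0,1]. Then the map t ↦ H_{i,t} := ∇²F_{S,t,i}(w_i(t)) is differentiable with derivative H'_{i,t} = −∇²ℓ_i(w_i(t)) + ∇³F_{S,t,i}(w_i(t))[w_i'(t)], and for every t ∈ [0,1], ‖H'_{i,t}‖_op ≤ H + β̄·G/α, where β̄ := N·β + λ·β_R. -/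
open scoped RealInnerProductSpace BigOperators

lemma grad_eq {d : ℕ} (f : EuclideanSpace ℝ (Fin d) → ℝ) :
    gradient f = fun w => (InnerProductSpace.toDual ℝ (EuclideanSpace ℝ (Fin d))).symm
      (fderiv ℝ f w) := rfl

lemma grad_contDiff {d : ℕ} {f : EuclideanSpace ℝ (Fin d) → ℝ} (hf : ContDiff ℝ 3 f) :
    ContDiff ℝ 2 (gradient f) := by
  have h : ContDiff ℝ 2 (fderiv ℝ f) := hf.fderiv_right (by norm_num)
  rw [grad_eq]
  exact (InnerProductSpace.toDual ℝ
    (EuclideanSpace ℝ (Fin d))).symm.toContinuousLinearEquiv.contDiff.comp h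

lemma hess_contDiff {d : ℕ} {f : EuclideanSpace ℝ (Fin d) → ℝ} (hf : ContDiff ℝ 3 f) :
    ContDiff ℝ 1 (hessian f) :=
  (grad_contDiff hf).fderiv_right (by norm_num)

lemma grad_diff {d : ℕ} {f : EuclideanSpace ℝ (Fin d) → ℝ} (hf : ContDiff ℝ 3 f) :
    Differentiable ℝ (gradient f) := (grad_contDiff hf).differentiable (by norm_num)

lemma grad_add' {d : ℕ} {f g : EuclideanSpace ℝ (Fin d) → ℝ} (hf : ContDiff ℝ 3 f)
    (hg : ContDiff ℝ 3 g) (c : ℝ) :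
    gradient (fun w => f w + c * g w) = fun w => gradient f w + c • gradient g w := by
  have h1 := hf.differentiable (by norm_num)
  have h2 := hg.differentiable (by norm_num)
  funext w
  simp only [grad_eq]
  rw [fderiv_fun_add (h1 w) ((h2 w).const_mul c), fderiv_const_mul (h2 w)]
  simp

lemma hess_add' {d : ℕ} {f g : EuclideanSpace ℝ (Fin d) → ℝ} (hf : ContDiff ℝ 3 f)
    (hg : ContDiff ℝ 3 g) (c : ℝ) :
    hessian (fun w => f w + c * g w) = fun w => hessian f w + c • hessian g w := by
  have h1 := grad_diff hf
  have h2 := grad_diff hg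
  funext w
  simp only [hessian, grad_add' hf hg]
  exact ((h1 w).hasFDerivAt.add ((h2 w).hasFDerivAt.const_smul c)).fderiv

lemma hess_zero {d : ℕ} : hessian (fun _ : EuclideanSpace ℝ (Fin d) => (0:ℝ)) = 0 := by
  have : gradient (fun _ : EuclideanSpace ℝ (Fin d) => (0:ℝ)) = fun _ => 0 := by
    funext w; simp [grad_eq]
  funext w
  simp [hessian, this]

lemma hess_sum {d : ℕ} {ι : Type*} (s : Finset ι) (c : ι → ℝ)
    (l : ι → EuclideanSpace ℝ (Fin d) → ℝ) (hl : ∀ i, ContDiff ℝ 3 (l i)) :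
    hessian (fun w => ∑ j ∈ s, c j * l j w) = fun w => ∑ j ∈ s, c j • hessian (l j) w := by
  classical
  induction s using Finset.induction_on with
  | empty => simp only [Finset.sum_empty]; exact hess_zero
  | insert a s ha ih =>
    have h : ContDiff ℝ 3 (fun w => ∑ j ∈ s, c j * l j w) :=
      ContDiff.sum fun j _ => contDiff_const.mul (hl j)
    simp only [Finset.sum_insert ha]
    have := hess_add' h (hl a) (c a)
    rw [ih] at this
    rw [show (fun w => c a * l a w + ∑ j ∈ s, c j * l j w) =
      fun w => ∑ j ∈ s, c j * l j w + c a * l a w from funext fun w => add_comm _ _, this]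
    funext w
    exact add_comm _ _

set_option maxHeartbeats 2000000 in
/-- the map `t ↦ H_{i,t} = ∇²F_{S,t,i}(w_i(t))` is differentiable with derivative
`H'_{i,t} = −∇²ℓ_i(w_i(t)) + ∇³F_{S,t,i}(w_i(t))[w_i'(t)]`, and `‖H'_{i,t}‖ ≤ H + β̄·G/α`
where `β̄ = N·β + λ·β_R`. -/
theorem stmt4 {d N : ℕ} (hd : 1 ≤ d) (hN : 1 ≤ N)
    (l : Fin N → EuclideanSpace ℝ (Fin d) → ℝ)
    (Reg : EuclideanSpace ℝ (Fin d) → ℝ)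
    (lam G H β βR α : ℝ) (hlam : 0 < lam) (hα : 0 < α)
    -- (A1) smooth losses (C³)
    (hl : ∀ i, ContDiff ℝ 3 (l i))
    (hlG : ∀ i w, ‖gradient (l i) w‖ ≤ G)
    (hlH : ∀ i w, ‖hessian (l i) w‖ ≤ H)
    (hlLip : ∀ i w v, ‖hessian (l i) w - hessian (l i) v‖ ≤ β * ‖w - v‖)
    -- (A2) smooth regularizer (C³)
    (hReg : ContDiff ℝ 3 Reg)
    (hRegLip : ∀ w v, ‖hessian Reg w - hessian Reg v‖ ≤ βR * ‖w - v‖)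
    -- (A3) strong convexity of every F_{S,t,i}
    (hSC : ∀ (i : Fin N) (t : ℝ), t ∈ Set.Icc (0 : ℝ) 1 →
      ∀ w v : EuclideanSpace ℝ (Fin d),
        α * ‖v‖ ^ 2 ≤ ⟪hessian (FSt l Reg lam i t) w v, v⟫)
    -- the curve: continuously differentiable, first-order optimal along the path
    (i : Fin N) (w w' : ℝ → EuclideanSpace ℝ (Fin d))
    (hw : ∀ t ∈ Set.Icc (0 : ℝ) 1, HasDerivWithinAt w (w' t) (Set.Icc (0 : ℝ) 1) t)
    (hw' : ContinuousOn w' (Set.Icc (0 : ℝ) 1))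
    (hopt : ∀ t ∈ Set.Icc (0 : ℝ) 1, gradient (FSt l Reg lam i t) (w t) = 0) :
    ∀ t ∈ Set.Icc (0 : ℝ) 1,
      HasDerivWithinAt (fun s => hessian (FSt l Reg lam i s) (w s))
        (-(hessian (l i) (w t))
          + fderiv ℝ (hessian (FSt l Reg lam i t)) (w t) (w' t))
        (Set.Icc (0 : ℝ) 1) t ∧
      ‖-(hessian (l i) (w t))
          + fderiv ℝ (hessian (FSt l Reg lam i t)) (w t) (w' t)‖
        ≤ H + ((N : ℝ) * β + lam * βR) * G / α := by
  classical
  intro t ht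
  have hFS : ContDiff ℝ 3 (FS l Reg lam) :=
    (ContDiff.sum fun j _ => hl j).add (contDiff_const.mul hReg)
  have hFeq : ∀ s, FSt l Reg lam i s = fun w => FS l Reg lam w + (-s) * l i w := by
    intro s; funext x; simp only [FSt]; ring
  have hFSt : ContDiff ℝ 3 (FSt l Reg lam i t) := by
    rw [hFeq]; exact hFS.add (contDiff_const.mul (hl i))
  have hgr : ∀ s, gradient (FSt l Reg lam i s) = _ := fun s => by
    rw [hFeq s, grad_add' hFS (hl i)]
  have hhe : ∀ s, hessian (FSt l Reg lam i s) = _ := fun s => by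
    rw [hFeq s, hess_add' hFS (hl i)]
  have hneg : HasDerivWithinAt (fun s : ℝ => -s) (-1) (Set.Icc (0 : ℝ) 1) t :=
    (hasDerivWithinAt_id t _).neg
  -- generic composition
  have key1 := hess_contDiff hFS
  have key2 := hess_contDiff (hl i)
  have d1 := (key1.differentiable (by norm_num)) (w t)
  have d2 := (key2.differentiable (by norm_num)) (w t)
  have hmain : HasDerivWithinAt (fun s => hessian (FSt l Reg lam i s) (w s))
        (-(hessian (l i) (w t))
          + fderiv ℝ (hessian (FSt l Reg lam i t)) (w t) (w' t))
        (Set.Icc (0 : ℝ) 1) t := by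
    have e1 := d1.hasFDerivAt.comp_hasDerivWithinAt t (hw t ht)
    have e2 := d2.hasFDerivAt.comp_hasDerivWithinAt t (hw t ht)
    have e := e1.add (hneg.smul e2)
    have hfd : fderiv ℝ (hessian (FSt l Reg lam i t)) (w t) =
        fderiv ℝ (hessian (FS l Reg lam)) (w t) + (-t) • fderiv ℝ (hessian (l i)) (w t) := by
      rw [hhe]; exact (d1.hasFDerivAt.add (d2.hasFDerivAt.const_smul (-t))).fderiv
    have hfun : (fun s => hessian (FSt l Reg lam i s) (w s)) =
        hessian (FS l Reg lam) ∘ w + (fun s : ℝ => -s) • (hessian (l i) ∘ w) := by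
      funext s; rw [hhe]; rfl
    have hval : (fderiv ℝ (hessian (FS l Reg lam)) (w t)) (w' t) +
        (-t • (fderiv ℝ (hessian (l i)) (w t)) (w' t) + (-1 : ℝ) • (hessian (l i) ∘ w) t) =
        -(hessian (l i) (w t)) + (fderiv ℝ (hessian (FS l Reg lam)) (w t) +
          (-t) • fderiv ℝ (hessian (l i)) (w t)) (w' t) := by
      have hm : (-1 : ℝ) • (hessian (l i) ∘ w) t = -(hessian (l i) (w t)) := by
        ext v; simp
      rw [add_apply, smul_apply, hm]
      abel
    rw [hfd, hfun, ← hval]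
    exact e
  refine ⟨hmain, ?_⟩
  -- bound on w'
  have hopt' : hessian (FSt l Reg lam i t) (w t) (w' t) = gradient (l i) (w t) := by
    have g1 := (grad_diff hFS) (w t)
    have g2 := (grad_diff (hl i)) (w t)
    have e1 := g1.hasFDerivAt.comp_hasDerivWithinAt t (hw t ht)
    have e2 := g2.hasFDerivAt.comp_hasDerivWithinAt t (hw t ht)
    have e := e1.add (hneg.smul e2)
    have z : HasDerivWithinAt (fun _ : ℝ => (0 : EuclideanSpace ℝ (Fin d))) 0
      (Set.Icc (0 : ℝ) 1) t := hasDerivWithinAt_const _ _ _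
    have z' := e.congr_of_mem (f₁ := fun _ : ℝ => (0 : EuclideanSpace ℝ (Fin d)))
      (fun s hs => by
        have := hopt s hs
        rw [hgr] at this
        exact this.symm) ht
    have u := (uniqueDiffOn_Icc (zero_lt_one (α := ℝ)) t ht).eq_deriv _ z z'
    rw [hhe]
    simp only [hessian, add_apply, smul_apply]
    simp only [neg_smul, one_smul, Function.comp] at u
    rw [neg_smul, ← sub_eq_zero, u]
    abel
  have hwb : ‖w' t‖ ≤ G / α := by
    have h1 := hSC i t ht (w t) (w' t)
    rw [hopt'] at h1
    have h2 := real_inner_le_norm (gradient (l i) (w t)) (w' t)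
    have h3 := mul_le_mul_of_nonneg_right (hlG i (w t)) (norm_nonneg (w' t))
    have hG : 0 ≤ G := (norm_nonneg _).trans (hlG i (w t))
    rw [le_div_iff₀ hα]
    rcases (norm_nonneg (w' t)).eq_or_lt with h0 | h0
    · rw [← h0]; simpa using hG
    · refine le_of_mul_le_mul_right ?_ h0
      nlinarith
  -- nonnegativity
  obtain ⟨x, hx⟩ : ∃ x : EuclideanSpace ℝ (Fin d), ‖x‖ = 1 :=
    ⟨EuclideanSpace.single ⟨0, hd⟩ 1, by simp⟩
  have hβ : 0 ≤ β := by
    have := (norm_nonneg _).trans (hlLip i x 0); simpa [hx] using this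
  have hβR : 0 ≤ βR := by
    have := (norm_nonneg _).trans (hRegLip x 0); simpa [hx] using this
  have hnn : 0 ≤ (N : ℝ) * β + lam * βR := by positivity
  -- Lipschitz
  let c : Fin N → ℝ := fun j => if j = i then 1 - t else 1
  have hc : ∀ j, |c j| ≤ 1 := by
    intro j
    simp only [c]
    split_ifs
    · rw [abs_le]; constructor <;> linarith [ht.1, ht.2]
    · simp
  have hF2 : FSt l Reg lam i t = fun w => (∑ j, c j * l j w) + lam * Reg w := by
    funext x
    have : ∀ j, c j * l j x = l j x - if j = i then t * l j x else 0 := by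
      intro j; simp only [c]; split_ifs <;> ring
    simp only [FSt, FS, this, Finset.sum_sub_distrib, Finset.sum_ite_eq', Finset.mem_univ, if_true]
    ring
  have hlip : ∀ x y, ‖hessian (FSt l Reg lam i t) x - hessian (FSt l Reg lam i t) y‖ ≤
      ((N : ℝ) * β + lam * βR) * ‖x - y‖ := by
    intro x y
    rw [hF2, hess_add' (ContDiff.sum fun j _ => contDiff_const.mul (hl j)) hReg,
      hess_sum _ _ _ hl]
    have : (∑ j, c j • hessian (l j) x + lam • hessian Reg x) -
        (∑ j, c j • hessian (l j) y + lam • hessian Reg y) =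
        ∑ j, c j • (hessian (l j) x - hessian (l j) y) +
          lam • (hessian Reg x - hessian Reg y) := by
      simp only [smul_sub, Finset.sum_sub_distrib]; abel
    simp only [this]
    refine (norm_add_le _ _).trans ?_
    have s1 : ‖∑ j, c j • (hessian (l j) x - hessian (l j) y)‖ ≤ ∑ j : Fin N, β * ‖x - y‖ := by
      refine norm_sum_le_of_le _ fun j _ => ?_
      rw [norm_smul, Real.norm_eq_abs]
      calc _ ≤ 1 * (β * ‖x - y‖) :=
            mul_le_mul (hc j) (hlLip j x y) (norm_nonneg _) zero_le_one
        _ = _ := one_mul _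
    have s2 : ‖lam • (hessian Reg x - hessian Reg y)‖ ≤ lam * (βR * ‖x - y‖) := by
      rw [norm_smul, Real.norm_eq_abs, abs_of_pos hlam]
      exact mul_le_mul_of_nonneg_left (hRegLip x y) hlam.le
    simp at s1
    linarith
  have hfb : ‖fderiv ℝ (hessian (FSt l Reg lam i t)) (w t)‖ ≤ (N : ℝ) * β + lam * βR := by
    have : LipschitzWith ⟨_, hnn⟩ (hessian (FSt l Reg lam i t)) :=
      LipschitzWith.of_dist_le_mul fun x y => by
        rw [dist_eq_norm, dist_eq_norm]; exact hlip x y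
    exact norm_fderiv_le_of_lipschitz ℝ this
  refine (norm_add_le _ _).trans (add_le_add (by rw [norm_neg]; exact hlH i _) ?_)
  rw [mul_div_assoc]
  exact (ContinuousLinearMap.le_opNorm _ _).trans
    (mul_le_mul hfb hwb (norm_nonneg _) hnn)
end

section
/- Fix i ∈ {1,…,N} and suppose w_i : [0,1] → ℝ^d is twice continuously differentiable with ∇F_{S,t,i}(w_i(t)) = 0 for every t ∈ [0,1]. Then for every t ∈ [0,1], ‖w_i''(t)‖ ≤ 2HG/α² + β̄G²/α³, where β̄ := N·β + λ·β_R. -/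
open scoped RealInnerProductSpace BigOperators

section helpers
variable {d : ℕ}

lemma aux_grad_contDiff {f : EuclideanSpace ℝ (Fin d) → ℝ} (hf : ContDiff ℝ 3 f) :
    ContDiff ℝ 2 (gradient f) := by
  have h : ContDiff ℝ 2 (fderiv ℝ f) := hf.fderiv_right (by norm_num)
  exact (InnerProductSpace.toDual ℝ
    (EuclideanSpace ℝ (Fin d))).symm.toContinuousLinearEquiv.contDiff.comp h

lemma aux_hess_contDiff {f : EuclideanSpace ℝ (Fin d) → ℝ} (hf : ContDiff ℝ 3 f) :
    ContDiff ℝ 1 (hessian f) :=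
  (aux_grad_contDiff hf).fderiv_right (by norm_num)

lemma aux_grad_hasFDerivAt {f : EuclideanSpace ℝ (Fin d) → ℝ} (hf : ContDiff ℝ 3 f)
    (x : EuclideanSpace ℝ (Fin d)) : HasFDerivAt (gradient f) (hessian f x) x :=
  ((aux_grad_contDiff hf).differentiable (by norm_num) x).hasFDerivAt

lemma aux_hess_hasFDerivAt {f : EuclideanSpace ℝ (Fin d) → ℝ} (hf : ContDiff ℝ 3 f)
    (x : EuclideanSpace ℝ (Fin d)) : HasFDerivAt (hessian f) (fderiv ℝ (hessian f) x) x :=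
  ((aux_hess_contDiff hf).differentiable (by norm_num) x).hasFDerivAt

lemma aux_grad_FS {N : ℕ} {l : Fin N → EuclideanSpace ℝ (Fin d) → ℝ}
    {Reg : EuclideanSpace ℝ (Fin d) → ℝ} {lam : ℝ} (hl : ∀ i, ContDiff ℝ 3 (l i))
    (hReg : ContDiff ℝ 3 Reg) :
    gradient (FS l Reg lam) = fun x => (∑ j, gradient (l j) x) + lam • gradient Reg x := by
  funext x
  have h1 : HasFDerivAt (FS l Reg lam)
      ((∑ j, fderiv ℝ (l j) x) + lam • fderiv ℝ Reg x) x :=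
    (HasFDerivAt.fun_sum fun j _ =>
      ((hl j).differentiable (by norm_num) x).hasFDerivAt).add
      ((hReg.differentiable (by norm_num) x).hasFDerivAt.const_mul lam)
  simp [gradient, h1.fderiv]

lemma aux_hess_FS {N : ℕ} {l : Fin N → EuclideanSpace ℝ (Fin d) → ℝ}
    {Reg : EuclideanSpace ℝ (Fin d) → ℝ} {lam : ℝ} (hl : ∀ i, ContDiff ℝ 3 (l i))
    (hReg : ContDiff ℝ 3 Reg) (x : EuclideanSpace ℝ (Fin d)) :
    hessian (FS l Reg lam) x = (∑ j, hessian (l j) x) + lam • hessian Reg x := by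
  rw [hessian, aux_grad_FS hl hReg]
  exact ((HasFDerivAt.fun_sum fun j _ => aux_grad_hasFDerivAt (hl j) x).add
    ((aux_grad_hasFDerivAt hReg x).const_smul lam)).fderiv

lemma aux_FS_contDiff {N : ℕ} {l : Fin N → EuclideanSpace ℝ (Fin d) → ℝ}
    {Reg : EuclideanSpace ℝ (Fin d) → ℝ} {lam : ℝ} (hl : ∀ i, ContDiff ℝ 3 (l i))
    (hReg : ContDiff ℝ 3 Reg) : ContDiff ℝ 3 (FS l Reg lam) :=
  (ContDiff.sum fun j _ => hl j).add (contDiff_const.mul hReg)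

lemma aux_grad_sub {f g : EuclideanSpace ℝ (Fin d) → ℝ} (hf : ContDiff ℝ 3 f)
    (hg : ContDiff ℝ 3 g) (t : ℝ) :
    gradient (fun x => f x - t * g x) = fun x => gradient f x - t • gradient g x := by
  funext x
  have h1 : HasFDerivAt (fun x => f x - t * g x) (fderiv ℝ f x - t • fderiv ℝ g x) x :=
    (hf.differentiable (by norm_num) x).hasFDerivAt.sub
      ((hg.differentiable (by norm_num) x).hasFDerivAt.const_mul t)
  simp [gradient, h1.fderiv]

lemma aux_hess_sub {f g : EuclideanSpace ℝ (Fin d) → ℝ} (hf : ContDiff ℝ 3 f)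
    (hg : ContDiff ℝ 3 g) (t : ℝ) (x : EuclideanSpace ℝ (Fin d)) :
    hessian (fun x => f x - t * g x) x = hessian f x - t • hessian g x := by
  rw [hessian, aux_grad_sub hf hg]
  exact ((aux_grad_hasFDerivAt hf x).sub ((aux_grad_hasFDerivAt hg x).const_smul t)).fderiv

lemma aux_coercive {α : ℝ} (hα : 0 < α)
    (A : EuclideanSpace ℝ (Fin d) →L[ℝ] EuclideanSpace ℝ (Fin d))
    (hA : ∀ v, α * ‖v‖ ^ 2 ≤ ⟪A v, v⟫) (v : EuclideanSpace ℝ (Fin d)) :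
    α * ‖v‖ ≤ ‖A v‖ := by
  rcases eq_or_ne v 0 with rfl | hv
  · simp
  · have hp : 0 < ‖v‖ := norm_pos_iff.mpr hv
    have h1 := (hA v).trans (real_inner_le_norm _ _)
    refine le_of_mul_le_mul_right ?_ hp
    linarith [sq ‖v‖, mul_assoc α ‖v‖ ‖v‖, congrArg (α * ·) (sq ‖v‖)]

end helpers

/-- along the deletion path, `‖w_i''(t)‖ ≤ 2HG/α² + β̄G²/α³`
where `β̄ = N·β + λ·β_R`. -/
theorem stmt5 {d N : ℕ} (hd : 1 ≤ d) (hN : 1 ≤ N)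
    (l : Fin N → EuclideanSpace ℝ (Fin d) → ℝ)
    (Reg : EuclideanSpace ℝ (Fin d) → ℝ)
    (lam G H β βR α : ℝ) (hlam : 0 < lam) (hα : 0 < α)
    -- (A1) smooth losses (C³)
    (hl : ∀ i, ContDiff ℝ 3 (l i))
    (hlG : ∀ i w, ‖gradient (l i) w‖ ≤ G)
    (hlH : ∀ i w, ‖hessian (l i) w‖ ≤ H)
    (hlLip : ∀ i w v, ‖hessian (l i) w - hessian (l i) v‖ ≤ β * ‖w - v‖)
    -- (A2) smooth regularizer (C³)
    (hReg : ContDiff ℝ 3 Reg)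
    (hRegLip : ∀ w v, ‖hessian Reg w - hessian Reg v‖ ≤ βR * ‖w - v‖)
    -- (A3) strong convexity of every F_{S,t,i}
    (hSC : ∀ (i : Fin N) (t : ℝ), t ∈ Set.Icc (0 : ℝ) 1 →
      ∀ w v : EuclideanSpace ℝ (Fin d),
        α * ‖v‖ ^ 2 ≤ ⟪hessian (FSt l Reg lam i t) w v, v⟫)
    -- the curve: twice continuously differentiable, first-order optimal along the path
    (i : Fin N) (w w' w'' : ℝ → EuclideanSpace ℝ (Fin d))
    (hw : ∀ t ∈ Set.Icc (0 : ℝ) 1, HasDerivWithinAt w (w' t) (Set.Icc (0 : ℝ) 1) t)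
    (hw' : ∀ t ∈ Set.Icc (0 : ℝ) 1, HasDerivWithinAt w' (w'' t) (Set.Icc (0 : ℝ) 1) t)
    (hw'' : ContinuousOn w'' (Set.Icc (0 : ℝ) 1))
    (hopt : ∀ t ∈ Set.Icc (0 : ℝ) 1, gradient (FSt l Reg lam i t) (w t) = 0) :
    ∀ t ∈ Set.Icc (0 : ℝ) 1,
      ‖w'' t‖ ≤ 2 * H * G / α ^ 2 + ((N : ℝ) * β + lam * βR) * G ^ 2 / α ^ 3 := by
  intro t ht
  have hu : UniqueDiffOn ℝ (Set.Icc (0 : ℝ) 1) := uniqueDiffOn_Icc zero_lt_one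
  have hF : ContDiff ℝ 3 (FS l Reg lam) := aux_FS_contDiff hl hReg
  have hβ : 0 ≤ β := by
    obtain ⟨v, hv⟩ : ∃ v : EuclideanSpace ℝ (Fin d), v ≠ 0 :=
      ⟨EuclideanSpace.single ⟨0, hd⟩ 1, by simp⟩
    have h := (norm_nonneg _).trans (hlLip i v 0)
    rw [sub_zero] at h
    exact nonneg_of_mul_nonneg_left h (norm_pos_iff.mpr hv)
  have hG : 0 ≤ G := (norm_nonneg _).trans (hlG i 0)
  have hH : 0 ≤ H := (norm_nonneg _).trans (hlH i 0)
  have hgr : ∀ s x, gradient (FSt l Reg lam i s) x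
      = gradient (FS l Reg lam) x - s • gradient (l i) x := fun s x =>
    congrFun (aux_grad_sub hF (hl i) s) x
  have hhe : ∀ s x, hessian (FSt l Reg lam i s) x
      = hessian (FS l Reg lam) x - s • hessian (l i) x := fun s x =>
    aux_hess_sub hF (hl i) s x
  -- first derivative identity
  have h1 : ∀ s ∈ Set.Icc (0 : ℝ) 1, hessian (FS l Reg lam) (w s) (w' s)
      - s • hessian (l i) (w s) (w' s) = gradient (l i) (w s) := by
    intro s hs
    have a1 := (aux_grad_hasFDerivAt hF (w s)).comp_hasDerivWithinAt s (hw s hs)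
    have a2 := (aux_grad_hasFDerivAt (hl i) (w s)).comp_hasDerivWithinAt s (hw s hs)
    have a3 := a1.sub ((hasDerivWithinAt_id s (Set.Icc (0 : ℝ) 1)).smul a2)
    have a4 : HasDerivWithinAt (fun _ : ℝ => (0 : EuclideanSpace ℝ (Fin d))) 0
        (Set.Icc (0 : ℝ) 1) s := hasDerivWithinAt_const _ _ _
    have a5 := a4.congr_of_mem (f₁ := fun r : ℝ => gradient (FS l Reg lam) (w r) -
      r • gradient (l i) (w r)) (by
        intro r hr
        have := hopt r hr
        rw [hgr] at this
        exact this) hs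
    have a6 := (hu s hs).eq_deriv _ a3 a5
    simp only [id, one_smul] at a6
    have a7 := sub_eq_zero.mp a6
    rw [a7]
    simp
  -- second derivative identity
  have h2 : hessian (FSt l Reg lam i t) (w t) (w'' t)
      = (2 : ℝ) • hessian (l i) (w t) (w' t)
        - (fderiv ℝ (hessian (FS l Reg lam)) (w t) - t • fderiv ℝ (hessian (l i)) (w t))
          (w' t) (w' t) := by
    have a1 := ((aux_hess_hasFDerivAt hF (w t)).comp_hasDerivWithinAt t (hw t ht)).clm_apply
      (hw' t ht)
    have a2 := ((aux_hess_hasFDerivAt (hl i) (w t)).comp_hasDerivWithinAt t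
      (hw t ht)).clm_apply (hw' t ht)
    have a3 := a1.sub ((hasDerivWithinAt_id t (Set.Icc (0 : ℝ) 1)).smul a2)
    have a4 := (aux_grad_hasFDerivAt (hl i) (w t)).comp_hasDerivWithinAt t (hw t ht)
    have a5 := a3.congr_of_mem (f₁ := gradient (l i) ∘ w) (by
        intro r hr
        have := h1 r hr
        simpa using this.symm) ht
    have a6 := (hu t ht).eq_deriv _ a4 a5
    simp only [id, one_smul, Function.comp] at a6
    rw [hhe]
    simp only [sub_apply, smul_apply, two_smul]
    nth_rewrite 1 [a6]
    simp only [smul_add]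
    abel
  have hco := aux_coercive hα _ (hSC i t ht (w t))
  -- Lipschitz bound
  have h3 : ‖fderiv ℝ (hessian (FS l Reg lam)) (w t) - t • fderiv ℝ (hessian (l i)) (w t)‖
      ≤ (N : ℝ) * β + lam * βR := by
    have hN1 : (1 : ℝ) ≤ N := by exact_mod_cast hN
    have b1 := (aux_hess_hasFDerivAt hF (w t)).sub
      ((aux_hess_hasFDerivAt (hl i) (w t)).const_smul t)
    have hBnn : 0 ≤ (N : ℝ) * β + lam * βR := by
      obtain ⟨v, hv⟩ : ∃ v : EuclideanSpace ℝ (Fin d), v ≠ 0 :=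
        ⟨EuclideanSpace.single ⟨0, hd⟩ 1, by simp⟩
      have h := (norm_nonneg _).trans (hRegLip v 0)
      rw [sub_zero] at h
      have := nonneg_of_mul_nonneg_left h (norm_pos_iff.mpr hv)
      positivity
    refine b1.le_of_lip' hBnn (Filter.Eventually.of_forall fun x => ?_)
    have b2 : (hessian (FS l Reg lam) - t • hessian (l i)) x
        - (hessian (FS l Reg lam) - t • hessian (l i)) (w t)
        = (∑ j, (if j = i then 1 - t else 1) • (hessian (l j) x - hessian (l j) (w t)))
          + lam • (hessian Reg x - hessian Reg (w t)) := by
      have b3 : ∀ j, (if j = i then 1 - t else 1) • (hessian (l j) x - hessian (l j) (w t))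
          = (hessian (l j) x - hessian (l j) (w t))
            - (if j = i then t • (hessian (l j) x - hessian (l j) (w t)) else 0) := by
        intro j
        split_ifs
        · module
        · simp
      simp only [b3, Finset.sum_sub_distrib, Finset.sum_ite_eq', Finset.mem_univ, if_true,
        Pi.sub_apply, Pi.smul_apply, aux_hess_FS hl hReg, smul_sub]
      abel
    have b4 : ∀ j ∈ (Finset.univ : Finset (Fin N)),
        ‖(if j = i then 1 - t else 1) • (hessian (l j) x - hessian (l j) (w t))‖
          ≤ β * ‖x - w t‖ := by
      intro j _
      rw [norm_smul]
      have c1 : ‖(if j = i then 1 - t else 1 : ℝ)‖ ≤ 1 := by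
        split_ifs
        · rw [Real.norm_eq_abs, abs_le]; constructor <;> linarith [ht.1, ht.2]
        · simp
      exact (mul_le_of_le_one_left (norm_nonneg _) c1).trans (hlLip j _ _)
    have b5 := norm_sum_le_of_le _ b4
    have b6 : ‖lam • (hessian Reg x - hessian Reg (w t))‖ ≤ lam * (βR * ‖x - w t‖) := by
      rw [norm_smul, Real.norm_of_nonneg hlam.le]
      exact mul_le_mul_of_nonneg_left (hRegLip _ _) hlam.le
    have b7 : ‖(hessian (FS l Reg lam) - t • hessian (l i)) x
        - (hessian (FS l Reg lam) - t • hessian (l i)) (w t)‖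
        ≤ ((N : ℝ) * β + lam * βR) * ‖x - w t‖ := by
      rw [b2]
      refine (norm_add_le _ _).trans ((add_le_add b5 b6).trans (le_of_eq ?_))
      simp
      ring
    exact b7
  have h4 : α * ‖w' t‖ ≤ G := by
    refine (hco (w' t)).trans ?_
    rw [hhe]
    have := h1 t ht
    simp only [sub_apply, smul_apply]
    rw [this]
    exact hlG i _
  have h5 : ‖w' t‖ ≤ G / α := by
    rw [le_div_iff₀ hα]; linarith
  have hB : 0 ≤ (N : ℝ) * β + lam * βR := le_trans (ContinuousLinearMap.opNorm_nonneg _) h3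
  have h6 : α * ‖w'' t‖ ≤ 2 * (H * (G / α)) + ((N : ℝ) * β + lam * βR) * (G / α) * (G / α) := by
    refine (hco (w'' t)).trans ?_
    rw [h2]
    refine (norm_sub_le _ _).trans (add_le_add ?_ ?_)
    · rw [norm_smul, Real.norm_two]
      have := ((hessian (l i) (w t)).le_opNorm (w' t)).trans
        (mul_le_mul (hlH i _) h5 (norm_nonneg _) hH)
      linarith
    · refine (ContinuousLinearMap.le_opNorm₂ _ _ _).trans ?_
      gcongr
  have h7 : ‖w'' t‖ ≤ (2 * (H * (G / α)) + ((N : ℝ) * β + lam * βR) * (G / α) * (G / α)) / α := by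
    rw [le_div_iff₀ hα]; linarith
  refine h7.trans (le_of_eq ?_)
  field_simp
end

section
/- (Corollary: beneficial deletion condition for ridge regression.) Let d ≥ 1, N ≥ 1, R > 0, σ > 0, λ > 0. Let μ_1, …, μ_d ≥ 0 with Σ_{j=1}^d μ_j = N·R² and μ_j ≤ μ_max for all j, and let w̃_1, …, w̃_d ∈ ℝ with W := Σ_{j=1}^d w̃_j² > 0. Define SNR := R²·W/σ², D := 2·Σ_{j=1}^d [μ_j·(σ² − λ·w̃_j²)/(μ_j + λ)³], and C := 2·[ 3R⁴·W/λ² + σ²·( R²/λ² + (19/4)·R⁴/λ³ + (3/4)·R⁶/λ⁴ ) ]. Let k₁, k₂, k₃ > 0 satisfy 2(1 − k₃)/(1 + k₁)³ − (1 + 2k₂) > 0 and k₃ < 1. If max{ μ_max/(k₁R²), 19/(4k₂), √(3/(4k₂)) } < λ/R² < k₃/SNR and SNR < (1/3)·( 2(1 − k₃)/(1 + k₁)³ − (1 + 2k₂) ), then λ·D > C·N/2. -/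
open scoped BigOperators

/-- Corollary: beneficial deletion condition for ridge regression:
under the eigenvalue/parameter conditions and the stated range for `λ/R²` and the SNR bound,
the beneficial-deletion condition `λ·D > C·N/2` holds. -/
theorem stmt13 (d N : ℕ) (hd : 1 ≤ d) (hN : 1 ≤ N)
    (R σ lam μmax : ℝ) (hR : 0 < R) (hσ : 0 < σ) (hlam : 0 < lam)
    (μ : Fin d → ℝ) (hμ : ∀ j, 0 ≤ μ j)
    (hμsum : ∑ j, μ j = (N : ℝ) * R ^ 2)
    (hμmax : ∀ j, μ j ≤ μmax)
    (wt : Fin d → ℝ) (hW : 0 < ∑ j, (wt j) ^ 2)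
    (k₁ k₂ k₃ : ℝ) (hk₁ : 0 < k₁) (hk₂ : 0 < k₂) (hk₃ : 0 < k₃) (hk₃1 : k₃ < 1)
    (hks : 2 * (1 - k₃) / (1 + k₁) ^ 3 - (1 + 2 * k₂) > 0)
    -- λ/R² lies in the prescribed range
    (hrange₁ : max (max (μmax / (k₁ * R ^ 2)) (19 / (4 * k₂))) (Real.sqrt (3 / (4 * k₂)))
      < lam / R ^ 2)
    (hrange₂ : lam / R ^ 2
      < k₃ / (R ^ 2 * (∑ j, (wt j) ^ 2) / σ ^ 2))
    -- SNR bound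
    (hsnr : R ^ 2 * (∑ j, (wt j) ^ 2) / σ ^ 2
      < (1 / 3) * (2 * (1 - k₃) / (1 + k₁) ^ 3 - (1 + 2 * k₂))) :
    lam * (2 * ∑ j, μ j * (σ ^ 2 - lam * (wt j) ^ 2) / (μ j + lam) ^ 3)
      > (2 * (3 * R ^ 4 * (∑ j, (wt j) ^ 2) / lam ^ 2
          + σ ^ 2 * (R ^ 2 / lam ^ 2 + (19 / 4) * R ^ 4 / lam ^ 3
              + (3 / 4) * R ^ 6 / lam ^ 4))) * (N : ℝ) / 2 := by
  set W := ∑ j, (wt j) ^ 2 with hWdef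
  have hR2 : 0 < R ^ 2 := by positivity
  have hσ2 : 0 < σ ^ 2 := by positivity
  obtain ⟨h12, h3⟩ := max_lt_iff.1 hrange₁
  obtain ⟨h1, h2⟩ := max_lt_iff.1 h12
  have hx : 0 < lam / R ^ 2 := by positivity
  have hNpos : (0 : ℝ) < N := by exact_mod_cast hN
  have hmu : μmax < k₁ * lam := by
    rw [div_lt_div_iff₀ (by positivity) hR2] at h1
    have h1' : R ^ 2 * μmax < R ^ 2 * (k₁ * lam) := by linarith
    exact lt_of_mul_lt_mul_left h1' hR2.le
  have hWl : lam * W < k₃ * σ ^ 2 := by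
    rw [div_div_eq_mul_div, div_lt_div_iff₀ hR2 (by positivity)] at hrange₂
    have h' : R ^ 2 * (lam * W) < R ^ 2 * (k₃ * σ ^ 2) := by linarith
    exact lt_of_mul_lt_mul_left h' hR2.le
  have hb2 : 19 / 4 * (R ^ 2 / lam) < k₂ := by
    rw [div_lt_div_iff₀ (by positivity) hR2] at h2
    rw [← mul_div_assoc, div_lt_iff₀ hlam]
    linarith
  have hb3 : 3 / 4 * (R ^ 2 / lam) ^ 2 < k₂ := by
    rw [Real.sqrt_lt' hx, div_pow, div_lt_div_iff₀ (by positivity) (by positivity)] at h3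
    rw [div_pow, ← mul_div_assoc, div_lt_iff₀ (by positivity)]
    linarith
  have hterm : ∀ j, μ j * ((1 - k₃) * σ ^ 2 / ((1 + k₁) * lam) ^ 3)
      ≤ μ j * (σ ^ 2 - lam * (wt j) ^ 2) / (μ j + lam) ^ 3 := by
    intro j
    rw [mul_div_assoc (μ j)]
    have hj := hμ j
    have hj2 := hμmax j
    have hw : (wt j) ^ 2 ≤ W :=
      Finset.single_le_sum (f := fun j => (wt j) ^ 2) (fun i _ => sq_nonneg _) (Finset.mem_univ j)
    have hw2 : lam * (wt j) ^ 2 ≤ lam * W := mul_le_mul_of_nonneg_left hw hlam.le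
    have hnum : (1 - k₃) * σ ^ 2 ≤ σ ^ 2 - lam * (wt j) ^ 2 := by linarith
    have hpos : 0 ≤ (1 - k₃) * σ ^ 2 := mul_nonneg (by linarith) hσ2.le
    apply mul_le_mul_of_nonneg_left _ hj
    apply div_le_div₀ (hpos.trans hnum) hnum (by positivity)
    exact pow_le_pow_left₀ (by positivity) (by linarith) 3
  have hsum := Finset.sum_le_sum (fun j (_ : j ∈ Finset.univ) => hterm j)
  rw [← Finset.sum_mul, hμsum] at hsum
  have hsum2 := mul_le_mul_of_nonneg_left hsum (show 0 ≤ lam * 2 by positivity)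
  have e1 : lam * 2 * (N * R ^ 2 * ((1 - k₃) * σ ^ 2 / ((1 + k₁) * lam) ^ 3))
      = N * R ^ 2 * σ ^ 2 / lam ^ 2 * (2 * (1 - k₃) / (1 + k₁) ^ 3) := by
    field_simp
  have e2 : (2 * (3 * R ^ 4 * W / lam ^ 2
          + σ ^ 2 * (R ^ 2 / lam ^ 2 + (19 / 4) * R ^ 4 / lam ^ 3
              + (3 / 4) * R ^ 6 / lam ^ 4))) * (N : ℝ) / 2
      = N * R ^ 2 * σ ^ 2 / lam ^ 2 * (3 * (R ^ 2 * W / σ ^ 2) + 1 + 19 / 4 * (R ^ 2 / lam)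
        + 3 / 4 * (R ^ 2 / lam) ^ 2) := by
    field_simp
    try ring
  have hlt : N * R ^ 2 * σ ^ 2 / lam ^ 2 * (3 * (R ^ 2 * W / σ ^ 2) + 1 + 19 / 4 * (R ^ 2 / lam)
        + 3 / 4 * (R ^ 2 / lam) ^ 2)
      < N * R ^ 2 * σ ^ 2 / lam ^ 2 * (2 * (1 - k₃) / (1 + k₁) ^ 3) :=
    mul_lt_mul_of_pos_left (by linarith) (by positivity)
  rw [e2, gt_iff_lt, ← mul_assoc]
  rw [e1] at hsum2
  exact hlt.trans_le hsum2
end
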